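/- arXiv:math/0702166 — 2 statements merged into one kernel-verified Lean document; each statement's English description precedes it below -/
import Mathlib

section
/- Let n ≥ 5, let k ∈ {1, 2, ..., ⌊(n−1)/2⌋ − 1}, and let i ∈ {3, 4, ..., n−2k}. Then the sequence π = (n−k, k+i, 2^i, 1^{n−i−2}) is not potentially (K_5 − P_4)-graphic. -/
/-- The multiset of vertex degrees of a simple graph on `Fin n`. -/
noncomputable def degMS {n : ℕ} (G : SimpleGraph (Fin n)) : Multiset ℕ :=
  Finset.univ.val.map fun v => Nat.card {w // G.Adj v w}

/-- A list of naturals is graphic if it is the degree sequence (as a multiset)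
of a simple graph on `π.length` vertices. -/
def IsGraphic (π : List ℕ) : Prop :=
  ∃ G : SimpleGraph (Fin π.length), degMS G = ↑π

/-- `π` is potentially `H`-graphic: some realization of `π` contains a copy of `H`. -/
def Potentially {β : Type} (H : SimpleGraph β) (π : List ℕ) : Prop :=
  ∃ G : SimpleGraph (Fin π.length), degMS G = ↑π ∧
    ∃ f : β → Fin π.length, Function.Injective f ∧
      ∀ u v : β, H.Adj u v → G.Adj (f u) (f v)

/-- `K₅ - P₄`: complete graph on 5 vertices minus the edges of a path on 4 vertices. -/
def K5P4 : SimpleGraph (Fin 5) :=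
  (⊤ : SimpleGraph (Fin 5)) \ SimpleGraph.fromEdgeSet {s(0, 1), s(1, 2), s(2, 3)}

/-- `K₅ - Y₄`: complete graph on 5 vertices minus the edges of the tree `Y₄`
on 5 vertices with 3 leaves (star `K_{1,3}` with one edge subdivided):
edges `{0,1}, {0,2}, {0,3}, {3,4}`. -/
def K5Y4 : SimpleGraph (Fin 5) :=
  (⊤ : SimpleGraph (Fin 5)) \ SimpleGraph.fromEdgeSet {s(0, 1), s(0, 2), s(0, 3), s(3, 4)}

/-- A vertex with three distinct neighbours has degree at least three. -/
theorem three_le_card_of_adj {m : ℕ} (G : SimpleGraph (Fin m)) (v a b c : Fin m)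
    (ha : G.Adj v a) (hb : G.Adj v b) (hc : G.Adj v c)
    (hab : a ≠ b) (hac : a ≠ c) (hbc : b ≠ c) :
    3 ≤ Nat.card {w // G.Adj v w} := by
  classical
  rw [Nat.card_eq_fintype_card, Fintype.card_subtype]
  have h : ({a, b, c} : Finset (Fin m)) ⊆ Finset.univ.filter (fun w => G.Adj v w) := by
    intro x hx
    simp only [Finset.mem_insert, Finset.mem_singleton] at hx
    rcases hx with rfl | rfl | rfl <;> simp [ha, hb, hc]
  have := Finset.card_le_card h
  rwa [Finset.card_eq_three.2 ⟨a, b, c, hab, hac, hbc, rfl⟩] at this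

theorem K5P4_adj_iff (u v : Fin 5) : K5P4.Adj u v ↔
    u ≠ v ∧ ¬ (s(u, v) = s(0, 1) ∨ s(u, v) = s(1, 2) ∨ s(u, v) = s(2, 3)) := by
  simp only [K5P4, SimpleGraph.sdiff_adj, SimpleGraph.top_adj, SimpleGraph.fromEdgeSet_adj,
    Set.mem_insert_iff, Set.mem_singleton_iff]
  tauto

theorem not_potentially_K5P4_family2 (n k i : ℕ) (hn : 5 ≤ n)
    (hk1 : 1 ≤ k) (hk2 : k ≤ (n - 1) / 2 - 1) (hi1 : 3 ≤ i) (hi2 : i ≤ n - 2 * k) :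
    ¬ Potentially K5P4
      ((n - k) :: (k + i) :: (List.replicate i 2 ++ List.replicate (n - i - 2) 1)) := by
  rintro ⟨G, hdeg, f, hf, hadj⟩
  have key : ∀ u a b c : Fin 5, K5P4.Adj u a → K5P4.Adj u b → K5P4.Adj u c →
      a ≠ b → a ≠ c → b ≠ c → 3 ≤ Nat.card {w // G.Adj (f u) w} :=
    fun u a b c ha hb hc hab hac hbc =>
      three_le_card_of_adj G (f u) (f a) (f b) (f c) (hadj _ _ ha) (hadj _ _ hb) (hadj _ _ hc)
        (hf.ne hab) (hf.ne hac) (hf.ne hbc)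
  have h0 := key 0 2 3 4 (by rw [K5P4_adj_iff]; decide) (by rw [K5P4_adj_iff]; decide)
    (by rw [K5P4_adj_iff]; decide) (by decide) (by decide) (by decide)
  have h3 := key 3 0 1 4 (by rw [K5P4_adj_iff]; decide) (by rw [K5P4_adj_iff]; decide)
    (by rw [K5P4_adj_iff]; decide) (by decide) (by decide) (by decide)
  have h4 := key 4 0 1 2 (by rw [K5P4_adj_iff]; decide) (by rw [K5P4_adj_iff]; decide)
    (by rw [K5P4_adj_iff]; decide) (by decide) (by decide) (by decide)
  have hc := congrArg (Multiset.countP (fun d => 3 ≤ d)) hdeg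
  rw [Multiset.coe_countP, degMS, Multiset.countP_map] at hc
  have hle : List.countP (fun d => decide (3 ≤ d))
      ((n - k) :: (k + i) :: (List.replicate i 2 ++ List.replicate (n - i - 2) 1)) ≤ 2 := by
    simp only [List.countP_cons, List.countP_append, List.countP_replicate]
    norm_num
    split_ifs <;> omega
  rw [← hc] at hle
  have hsub : ({f 0, f 3, f 4} : Finset _) ⊆
      Finset.univ.filter (fun v => 3 ≤ Nat.card {w // G.Adj v w}) := by
    intro x hx
    simp only [Finset.mem_insert, Finset.mem_singleton] at hx
    rw [Finset.mem_filter]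
    refine ⟨Finset.mem_univ _, ?_⟩
    rcases hx with rfl | rfl | rfl
    exacts [h0, h3, h4]
  have h5 := Finset.card_le_card hsub
  rw [Finset.card_eq_three.2 ⟨f 0, f 3, f 4, hf.ne (by decide), hf.ne (by decide),
    hf.ne (by decide), rfl⟩] at h5
  have h6 := h5.trans hle
  omega
end

section
/- Let n and t be integers with t ≥ 1, n − 3 − t ≥ 1, and n − t even. Then the n-term sequence π = (3^3, 2^t, 1^{n−3−t}), consisting of three terms 3, t terms 2, and n−3−t terms 1, is potentially (K_5 − Y_4)-graphic. -/
/-- The oriented edge relation of the realization. -/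
def edgeR (t i j : ℕ) : Prop :=
  (i = 0 ∧ j = 1) ∨ (i = 0 ∧ j = 2) ∨ (i = 1 ∧ j = 2) ∨ (i = 0 ∧ j = 3) ∨ (i = 1 ∧ j = 3) ∨
  (i = 2 ∧ j = 4) ∨ (4 ≤ i ∧ j = i + 1 ∧ i ≤ t + 2) ∨
  (t + 4 ≤ i ∧ j = i + 1 ∧ (i - t) % 2 = 0)

/-- The realization. -/
def realG (t N : ℕ) : SimpleGraph (Fin N) where
  Adj u v := edgeR t u v ∨ edgeR t v u
  symm := ⟨fun _ _ h => h.symm⟩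
  loopless := ⟨fun u h => by unfold edgeR at h; omega⟩

lemma card_of_nbrs {N : ℕ} (P : Fin N → Prop) (s : Finset ℕ) (hs : ∀ a ∈ s, a < N)
    (h : ∀ w : Fin N, P w ↔ w.val ∈ s) : Nat.card {w // P w} = s.card := by
  have e : Nat.card (s : Set ℕ) = s.card := by simp
  rw [← e]
  refine Nat.card_congr ⟨fun w => ⟨w.1.val, by simpa using (h w.1).1 w.2⟩,
    fun a => ⟨⟨a.1, hs a.1 (by simpa using a.2)⟩, (h _).2 (by simpa using a.2)⟩, ?_, ?_⟩
  · intro w; rfl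
  · intro a; rfl

lemma deg_realG (t N : ℕ) (ht : 1 ≤ t) (hN : t + 4 ≤ N) (hev : (N - t) % 2 = 0) (v : Fin N) :
    Nat.card {w // (realG t N).Adj v w} =
      if v.val < 3 then 3 else if v.val < t + 3 then 2 else 1 := by
  obtain ⟨v, hv⟩ := v
  have key : ∀ s : Finset ℕ, (∀ a ∈ s, a < N) →
      (∀ w : ℕ, w < N → ((edgeR t v w ∨ edgeR t w v) ↔ w ∈ s)) →
      Nat.card {w // (realG t N).Adj ⟨v, hv⟩ w} = s.card := by
    intro s hs h
    exact card_of_nbrs _ s hs (fun w => h w.1 w.2)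
  unfold edgeR at key
  have three : ∀ a b c : ℕ, a < b → b < c → ({a, b, c} : Finset ℕ).card = 3 := by
    intro a b c h1 h2
    exact Finset.card_eq_three.2 ⟨a, b, c, by omega, by omega, by omega, rfl⟩
  have two : ∀ a b : ℕ, a < b → ({a, b} : Finset ℕ).card = 2 := by
    intro a b h1
    exact Finset.card_pair (by omega)
  by_cases h0 : v = 0
  · rw [key {1, 2, 3} (by simp; omega) (by intro w hw; simp only [Finset.mem_insert, Finset.mem_singleton]; grind)]
    rw [three _ _ _ (by omega) (by omega)]; simp [h0]
  by_cases h1 : v = 1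
  · rw [key {0, 2, 3} (by simp; omega) (by intro w hw; simp only [Finset.mem_insert, Finset.mem_singleton]; grind)]
    rw [three _ _ _ (by omega) (by omega)]; simp [h1]
  by_cases h2 : v = 2
  · rw [key {0, 1, 4} (by simp; omega) (by intro w hw; simp only [Finset.mem_insert, Finset.mem_singleton]; grind)]
    rw [three _ _ _ (by omega) (by omega)]; simp [h2]
  show _ = if v < 3 then 3 else if v < t + 3 then 2 else 1
  rw [if_neg (show ¬ v < 3 by omega)]
  by_cases h3 : v = 3
  · rw [key {0, 1} (by simp; omega) (by intro w hw; simp only [Finset.mem_insert, Finset.mem_singleton]; grind)]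
    rw [two _ _ (by omega), if_pos (by omega)]
  obtain ⟨p, hp, hpv⟩ : ∃ p, p < v ∧ ((v = 4 ∧ p = 2) ∨ (4 < v ∧ p = v - 1)) := by
    by_cases h4 : v = 4
    · exact ⟨2, by omega, by omega⟩
    · exact ⟨v - 1, by omega, by omega⟩
  by_cases h4 : v < t + 3
  · rw [key {p, v + 1} (by simp; omega) (by intro w hw; simp only [Finset.mem_insert, Finset.mem_singleton]; grind)]
    rw [two _ _ (by omega), if_pos h4]
  rw [if_neg h4]
  by_cases h5 : v = t + 3
  · rw [key {p} (by simp; omega) (by intro w hw; simp only [Finset.mem_singleton]; grind)]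
    simp
  by_cases h6 : (v - t) % 2 = 0
  · rw [key {v + 1} (by simp; omega) (by intro w hw; simp only [Finset.mem_singleton]; grind)]
    simp
  · rw [key {v - 1} (by simp; omega) (by intro w hw; simp only [Finset.mem_singleton]; grind)]
    simp

theorem potentially_K5Y4_33321_seq (n t : ℕ) (ht : 1 ≤ t)
    (hnt : 1 ≤ n - 3 - t) (heven : Even (n - t)) :
    Potentially K5Y4
      (3 :: 3 :: 3 :: (List.replicate t 2 ++ List.replicate (n - 3 - t) 1)) := by
  have hlen : (3 :: 3 :: 3 :: (List.replicate t 2 ++ List.replicate (n - 3 - t) 1)).length = n := by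
    simp; omega
  have hget : ∀ (i : ℕ) (hi : i < (3 :: 3 :: 3 :: (List.replicate t 2 ++ List.replicate (n - 3 - t) 1)).length),
      (3 :: 3 :: 3 :: (List.replicate t 2 ++ List.replicate (n - 3 - t) 1))[i] =
        if i < 3 then 3 else if i < t + 3 then 2 else 1 := by
    intro i hi
    match i with
    | 0 => rfl
    | 1 => rfl
    | 2 => rfl
    | k + 3 => simp [List.getElem_append]
  rw [Nat.even_iff] at heven
  generalize (3 :: 3 :: 3 :: (List.replicate t 2 ++ List.replicate (n - 3 - t) 1)) = l at *
  subst hlen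
  refine ⟨realG t l.length, ?_, fun i => ⟨![4, 0, 1, 3, 2] i, ?_⟩, ?_, ?_⟩
  · unfold degMS
    have : (fun v => Nat.card {w // (realG t l.length).Adj v w}) = l.get := by
      funext v
      rw [deg_realG t _ ht (by omega) heven v, List.get_eq_getElem, hget]
    rw [this]
    simp [Fin.univ_val_map]
  · fin_cases i <;> simp <;> omega
  · intro i j h
    simp only [Fin.mk.injEq] at h
    revert i j
    decide
  · intro u v h
    show edgeR t _ _ ∨ edgeR t _ _
    unfold K5Y4 at h
    fin_cases u <;> fin_cases v <;> simp [edgeR] at h ⊢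
end
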